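/- arXiv:2006.11899 — 2 statements merged into one kernel-verified Lean document; each statement's English description precedes it below -/
import Mathlib

section
/- Let t > 0. For every z ∈ ℂ with Im z > 0, the Cauchy transform of the semicircular distribution satisfies the quadratic equation t·G_{σ_t}(z)² − z·G_{σ_t}(z) + 1 = 0; equivalently, z − 1/G_{σ_t}(z) = t·G_{σ_t}(z), i.e. z − F_{σ_t}(z) = t·G_{σ_t}(z). -/
open MeasureTheory

/-- The Cauchy transform of a measure `μ` on `ℝ`: `G_μ(z) = ∫ (z - x)⁻¹ dμ(x)`. -/
noncomputable def cauchyTransform (μ : Measure ℝ) (z : ℂ) : ℂ :=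
  ∫ x, (z - (x : ℂ))⁻¹ ∂μ

/-- The semicircular distribution `σ_t` of variance `t`. -/
noncomputable def semicircle (t : ℝ) : Measure ℝ :=
  volume.withDensity (fun x => ENNReal.ofReal ((2 * Real.pi * t)⁻¹ * Real.sqrt (4 * t - x ^ 2)))

lemma sc_one_sub_ne {w u : ℂ} (hw : ‖w‖ < 1) (hu : ‖u‖ ≤ 1) : 1 - w * u ≠ 0 := by
  intro h
  have h1 : w * u = 1 := by linear_combination -h
  have h2 : ‖w‖ * ‖u‖ = 1 := by rw [← norm_mul, h1, norm_one]
  nlinarith [norm_nonneg w, norm_nonneg u]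

lemma sc_exists_w (ζ : ℂ) (hζ : ζ.im ≠ 0) : ∃ w : ℂ, w ≠ 0 ∧ ‖w‖ < 1 ∧ w + w⁻¹ = ζ := by
  obtain ⟨d, hd⟩ := IsAlgClosed.exists_eq_mul_self (ζ ^ 2 - 4)
  have key : ∀ w : ℂ, w * (ζ - w) = 1 → w ≠ 0 ∧ w + w⁻¹ = ζ := by
    intro w h
    have h0 : w ≠ 0 := by rintro rfl; simp at h
    refine ⟨h0, ?_⟩
    field_simp
    linear_combination -h
  have h1 : ((ζ + d) / 2) * (ζ - (ζ + d) / 2) = 1 := by linear_combination hd / 4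
  set w := (ζ + d) / 2
  obtain ⟨h0, hs⟩ := key w h1
  rcases lt_trichotomy ‖w‖ 1 with h | h | h
  · exact ⟨w, h0, h, hs⟩
  · exfalso
    apply hζ
    rw [← hs, Complex.inv_eq_conj h]
    simp
  · refine ⟨w⁻¹, inv_ne_zero h0, ?_, ?_⟩
    · rw [norm_inv]; exact inv_lt_one_of_one_lt₀ h
    · rw [inv_inv, add_comm, hs]

lemma sc_P (w : ℂ) (hw : ‖w‖ < 1) :
    ∫ θ in (0:ℝ)..2 * Real.pi, (1 - w * Complex.exp (θ * Complex.I))⁻¹ = 2 * Real.pi := by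
  have hd : DiffContOnCl ℂ (fun u : ℂ => (1 - w * u)⁻¹) (Metric.ball 0 |1|) := by
    apply DifferentiableOn.diffContOnCl
    intro u hu
    rw [abs_one, closure_ball _ one_ne_zero] at hu
    apply DifferentiableAt.differentiableWithinAt
    have := sc_one_sub_ne hw (mem_closedBall_zero_iff.1 hu)
    fun_prop (disch := assumption)
  have h := hd.circleAverage
  rw [Real.circleAverage_def] at h
  simp only [circleMap, zero_add, Complex.ofReal_one, one_mul, mul_zero, sub_zero, inv_one] at h
  rw [inv_smul_eq_iff₀ (by positivity)] at h
  rw [h]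
  simp

lemma sc_Q (w : ℂ) (hw : ‖w‖ < 1) :
    ∫ θ in (0:ℝ)..2 * Real.pi, (1 - w * Complex.exp (-(θ * Complex.I)))⁻¹ = 2 * Real.pi := by
  rw [← sc_P w hw]
  have := intervalIntegral.integral_comp_sub_left (a := 0) (b := 2 * Real.pi)
    (fun θ : ℝ => (1 - w * Complex.exp (θ * Complex.I))⁻¹) (2 * Real.pi)
  simp only [sub_self, sub_zero] at this
  rw [← this]
  congr 1
  ext θ
  congr 3
  rw [Complex.exp_eq_exp_iff_exists_int]
  refine ⟨-1, ?_⟩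
  push_cast
  ring

lemma sc_point (w s u v : ℂ) (hw : w ≠ 0) (hs : s ≠ 0) (huv : u * v = 1)
    (hP : 1 - w * u ≠ 0) (hQ : 1 - w * v ≠ 0) :
    (1 - ((u + v) / 2) ^ 2) * (s * (w + w⁻¹) - 2 * s * ((u + v) / 2))⁻¹ =
      (2 * s)⁻¹ * (((u + v) / 2 + (w + w⁻¹) / 2)
        - (1 - w ^ 2) / (2 * w) * ((1 - w * u)⁻¹ + (1 - w * v)⁻¹ - 1)) := by
  have e : s * (w + w⁻¹) - 2 * s * ((u + v) / 2) = s / w * ((1 - w * u) * (1 - w * v)) := by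
    field_simp
    linear_combination (-w ^ 2) * huv
  have e2 : (1 - w * u)⁻¹ + (1 - w * v)⁻¹ - 1 = (1 - w ^ 2) / ((1 - w * u) * (1 - w * v)) := by
    field_simp
    linear_combination (-w ^ 2) * huv
  have e3 : (1 - w * u) * (1 - w * v) = 1 + w ^ 2 - w * (u + v) := by
    linear_combination (w ^ 2) * huv
  have e4 : (1 - w * u) * (1 - w * v) ≠ 0 := mul_ne_zero hP hQ
  rw [e, e2]
  rw [e3] at e4 ⊢
  generalize hD : 1 + w ^ 2 - w * (u + v) = D at e4 ⊢
  have hv : v = (1 + w ^ 2 - D) / w - u := by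
    field_simp
    linear_combination -hD
  clear hD e e2 e3 hP hQ huv
  subst hv
  field_simp
  ring

lemma sc_I (w : ℂ) (s : ℝ) (hs : 0 < s) (h0 : w ≠ 0) (hw : ‖w‖ < 1) :
    ∫ θ in (0:ℝ)..2 * Real.pi, ((Real.sin θ : ℂ) ^ 2) *
      ((s * (w + w⁻¹) - 2 * s * Real.cos θ))⁻¹ = Real.pi * w / s := by
  have hsc : (s : ℂ) ≠ 0 := by exact_mod_cast hs.ne'
  have n1 : ∀ θ : ℝ, 1 - w * Complex.exp (θ * Complex.I) ≠ 0 := fun θ =>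
    sc_one_sub_ne hw (Complex.norm_exp_ofReal_mul_I θ).le
  have n2 : ∀ θ : ℝ, 1 - w * Complex.exp (-(θ * Complex.I)) ≠ 0 := fun θ =>
    sc_one_sub_ne hw (by
      have := (Complex.norm_exp_ofReal_mul_I (-θ)).le
      simpa using this)
  have c1 : Continuous fun θ : ℝ => (1 - w * Complex.exp (θ * Complex.I))⁻¹ :=
    Continuous.inv₀ (by fun_prop) n1
  have c2 : Continuous fun θ : ℝ => (1 - w * Complex.exp (-(θ * Complex.I)))⁻¹ :=
    Continuous.inv₀ (by fun_prop) n2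
  have hpt : ∀ θ : ℝ, ((Real.sin θ : ℂ) ^ 2) * ((s * (w + w⁻¹) - 2 * s * Real.cos θ))⁻¹ =
      (2 * s : ℂ)⁻¹ * (((Real.cos θ : ℝ) : ℂ) + (w + w⁻¹) / 2
        - (1 - w ^ 2) / (2 * w) * ((1 - w * Complex.exp (θ * Complex.I))⁻¹ +
          (1 - w * Complex.exp (-(θ * Complex.I)))⁻¹ - 1)) := by
    intro θ
    have hc : ((Real.cos θ : ℝ) : ℂ) =
        (Complex.exp (θ * Complex.I) + Complex.exp (-(θ * Complex.I))) / 2 := by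
      rw [Complex.ofReal_cos, Complex.cos, neg_mul]
    have hsn : (Real.sin θ : ℂ) ^ 2 = 1 - (Real.cos θ : ℂ) ^ 2 := by
      have := Real.sin_sq θ
      exact_mod_cast this
    rw [hsn, hc]
    exact sc_point w s _ _ h0 hsc (by rw [← Complex.exp_add]; simp) (n1 θ) (n2 θ)
  simp_rw [hpt]
  have cc : Continuous fun θ : ℝ => ((Real.cos θ : ℝ) : ℂ) := by fun_prop
  rw [intervalIntegral.integral_const_mul, intervalIntegral.integral_sub,
    intervalIntegral.integral_add, intervalIntegral.integral_const_mul,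
    intervalIntegral.integral_sub, intervalIntegral.integral_add, sc_P w hw, sc_Q w hw,
    intervalIntegral.integral_ofReal]
  · simp
    field_simp
    ring
  all_goals
    apply Continuous.intervalIntegrable
    fun_prop

lemma sc_half (f : ℝ → ℝ → ℂ) (hf : Continuous fun θ => f (Real.cos θ) ((Real.sin θ) ^ 2)) :
    ∫ θ in (0:ℝ)..2 * Real.pi, f (Real.cos θ) ((Real.sin θ) ^ 2) =
      2 * ∫ θ in (0:ℝ)..Real.pi, f (Real.cos θ) ((Real.sin θ) ^ 2) := by
  rw [← intervalIntegral.integral_add_adjacent_intervals (b := Real.pi)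
    (hf.intervalIntegrable _ _) (hf.intervalIntegrable _ _), two_mul (∫ θ in (0:ℝ)..Real.pi, _)]
  congr 1
  have := intervalIntegral.integral_comp_sub_left (a := 0) (b := Real.pi)
    (fun θ : ℝ => f (Real.cos θ) ((Real.sin θ) ^ 2)) (2 * Real.pi)
  rw [show 2 * Real.pi - Real.pi = Real.pi by ring, sub_zero] at this
  rw [← this]
  simp [Real.cos_two_pi_sub, Real.sin_two_pi_sub]

lemma sc_ne (z : ℂ) (hz : 0 < z.im) (x : ℝ) : z - (x : ℂ) ≠ 0 := by
  intro h
  have := congrArg Complex.im h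
  simp at this
  exact hz.ne' this

lemma sc_G (t : ℝ) (ht : 0 < t) (z : ℂ) (hz : 0 < z.im) :
    cauchyTransform (semicircle t) z =
      (Real.pi : ℂ)⁻¹ * ∫ θ in (0:ℝ)..2 * Real.pi, ((Real.sin θ : ℂ) ^ 2) *
        (z - 2 * (Real.sqrt t : ℝ) * Real.cos θ)⁻¹ := by
  set s := Real.sqrt t with hsdef
  have hs : 0 < s := Real.sqrt_pos.2 ht
  have hst : s ^ 2 = t := Real.sq_sqrt ht.le
  have hne := sc_ne z hz
  set g : ℝ → ℂ := fun x =>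
    (((2 * Real.pi * t)⁻¹ * Real.sqrt (4 * t - x ^ 2) : ℝ) : ℂ) * (z - (x : ℂ))⁻¹ with hg
  have gc : Continuous g := by
    apply Continuous.mul (by fun_prop)
    exact Continuous.inv₀ (by fun_prop) hne
  have h1 : cauchyTransform (semicircle t) z = ∫ x, g x := by
    unfold cauchyTransform semicircle
    rw [integral_withDensity_eq_integral_toReal_smul (by fun_prop) (by simp)]
    congr 1
    ext x
    rw [ENNReal.toReal_ofReal (by positivity), Complex.real_smul]
  have h2 : ∫ x, g x = ∫ x in (-(2 * s))..(2 * s), g x := by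
    rw [intervalIntegral.integral_of_le (by linarith)]
    symm
    apply setIntegral_eq_integral_of_forall_compl_eq_zero
    intro x hx
    have : 4 * t - x ^ 2 ≤ 0 := by
      rw [← hst]
      by_contra hcon
      push Not at hcon
      apply hx
      have := abs_lt_of_sq_lt_sq' (a := x) (b := 2 * s) (by linarith) (by linarith)
      exact ⟨this.1, this.2.le⟩
    simp [hg, Real.sqrt_eq_zero_of_nonpos this]
  have h3 := intervalIntegral.integral_deriv_smul_comp (a := 0) (b := Real.pi)
    (f := fun θ => 2 * s * Real.cos θ) (f' := fun θ => 2 * s * (-Real.sin θ)) (g := g)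
    (fun x _ => (Real.hasDerivAt_cos x).const_mul _) (by fun_prop) gc
  have h4 : ∫ x in (-(2 * s))..(2 * s), g x =
      ∫ θ in (0:ℝ)..Real.pi, (2 / Real.pi : ℂ) * (((Real.sin θ : ℂ) ^ 2) *
        (z - 2 * s * Real.cos θ)⁻¹) := by
    rw [intervalIntegral.integral_symm]
    simp only [Real.cos_zero, Real.cos_pi, mul_one, mul_neg] at h3
    rw [← h3, ← intervalIntegral.integral_neg]
    apply intervalIntegral.integral_congr
    intro θ hθ
    rw [Set.uIcc_of_le Real.pi_pos.le] at hθ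
    have hsin := Real.sin_nonneg_of_mem_Icc hθ
    have hsq : Real.sqrt (4 * t - (2 * s * Real.cos θ) ^ 2) = 2 * s * Real.sin θ := by
      rw [show 4 * t - (2 * s * Real.cos θ) ^ 2 = (2 * s * Real.sin θ) ^ 2 by
        rw [← hst]; linear_combination (-4 * s ^ 2) * Real.sin_sq_add_cos_sq θ]
      exact Real.sqrt_sq (by positivity)
    simp only [hg, Function.comp, hsq, Complex.real_smul]
    rw [← hst]
    have hsc : (s : ℂ) ≠ 0 := by exact_mod_cast hs.ne'
    have hpi : (Real.pi : ℂ) ≠ 0 := by exact_mod_cast Real.pi_ne_zero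
    push_cast
    generalize (z - 2 * (s : ℂ) * Complex.cos θ)⁻¹ = q
    field_simp
    try ring
  have hcont : Continuous fun θ : ℝ =>
      (((Real.sin θ ^ 2 : ℝ) : ℂ) * (z - 2 * s * Real.cos θ)⁻¹) := by
    apply Continuous.mul (by fun_prop)
    refine Continuous.inv₀ (by fun_prop) fun θ => ?_
    have := hne (2 * s * Real.cos θ)
    push_cast at this ⊢
    exact this
  have h5 := sc_half (fun c q => (q : ℂ) * (z - 2 * s * c)⁻¹) hcont
  simp only [Complex.ofReal_pow] at h5
  rw [h1, h2, h4, h5, intervalIntegral.integral_const_mul]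
  ring

lemma sc_main (t : ℝ) (ht : 0 < t) (z : ℂ) (hz : 0 < z.im) :
    (t : ℂ) * (cauchyTransform (semicircle t) z) ^ 2
      - z * cauchyTransform (semicircle t) z + 1 = 0 := by
  have hs : 0 < Real.sqrt t := Real.sqrt_pos.2 ht
  have hst : Real.sqrt t ^ 2 = t := Real.sq_sqrt ht.le
  rw [sc_G t ht z hz]
  generalize Real.sqrt t = s at *
  have hsc : (s : ℂ) ≠ 0 := by exact_mod_cast hs.ne'
  have hpi : (Real.pi : ℂ) ≠ 0 := by exact_mod_cast Real.pi_ne_zero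
  obtain ⟨w, h0, hw, hwz⟩ := sc_exists_w (z / s) (by
    rw [Complex.div_ofReal_im]; positivity)
  have hz' : z = s * (w + w⁻¹) := by rw [hwz]; field_simp
  rw [hz', sc_I w s hs h0 hw, ← hst]
  push_cast
  field_simp
  ring

/-- For `t > 0` and `Im z > 0`, `G_{σ_t}(z)` solves `t G² − z G + 1 = 0`; equivalently
`z − 1/G_{σ_t}(z) = t G_{σ_t}(z)`, i.e. `z − F_{σ_t}(z) = t G_{σ_t}(z)`. -/
theorem cauchyTransform_semicircle_quadratic (t : ℝ) (ht : 0 < t) (z : ℂ) (hz : 0 < z.im) :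
    (t : ℂ) * (cauchyTransform (semicircle t) z) ^ 2 - z * cauchyTransform (semicircle t) z + 1 = 0 ∧
    z - (cauchyTransform (semicircle t) z)⁻¹ = (t : ℂ) * cauchyTransform (semicircle t) z := by
  have h := sc_main t ht z hz
  refine ⟨h, ?_⟩
  generalize cauchyTransform (semicircle t) z = G at *
  have hG : G ≠ 0 := by
    rintro rfl
    simp at h
  field_simp
  linear_combination -h
end

section
/- Let t > 0, let ν be a probability measure on ℝ, and let z ∈ ℂ with Im z > 2√t. Then there exists exactly one w ∈ ℂ with Im w > Im(z)/2 satisfying the fixed-point equation w = z + t·G_{σ_t}( w + 1/G_ν(w) − z ). -/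
open MeasureTheory

lemma ct_norm_inv_le (w : ℂ) (hw : 0 < w.im) (x : ℝ) : ‖(w - (x:ℂ))⁻¹‖ ≤ w.im⁻¹ := by
  rw [norm_inv]
  apply inv_anti₀ hw
  have := Complex.abs_im_le_norm (w - (x:ℂ))
  simp at this
  exact (le_abs_self _).trans this

lemma ct_sub_ne (w : ℂ) (hw : 0 < w.im) (x : ℝ) : w - (x:ℂ) ≠ 0 := by
  intro h
  have := congrArg Complex.im h
  simp at this
  linarith

lemma ct_integrable (ν : Measure ℝ) [IsProbabilityMeasure ν] (w : ℂ) (hw : 0 < w.im) :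
    Integrable (fun x : ℝ => (w - (x : ℂ))⁻¹) ν := by
  apply Integrable.of_bound (C := w.im⁻¹)
  · apply Continuous.aestronglyMeasurable
    exact Continuous.inv₀ (by fun_prop) (ct_sub_ne w hw)
  · exact Filter.Eventually.of_forall (ct_norm_inv_le w hw)

lemma ct_norm_le (ν : Measure ℝ) [IsProbabilityMeasure ν] (w : ℂ) (hw : 0 < w.im) :
    ‖cauchyTransform ν w‖ ≤ w.im⁻¹ := by
  have := norm_integral_le_of_norm_le_const (μ := ν) (f := fun x : ℝ => (w - (x : ℂ))⁻¹)
    (Filter.Eventually.of_forall (ct_norm_inv_le w hw))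
  simpa [cauchyTransform] using this

lemma ct_im_neg (ν : Measure ℝ) [IsProbabilityMeasure ν] (w : ℂ) (hw : 0 < w.im) :
    (cauchyTransform ν w).im < 0 := by
  have h1 : (cauchyTransform ν w).im = ∫ x : ℝ, ((w - (x:ℂ))⁻¹).im ∂ν :=
    (integral_im (𝕜 := ℂ) (ct_integrable ν w hw)).symm
  have hpt : ∀ x : ℝ, 0 < -((w - (x:ℂ))⁻¹).im := by
    intro x
    have h0 : 0 < Complex.normSq (w - (x:ℂ)) := Complex.normSq_pos.2 (ct_sub_ne w hw x)
    rw [Complex.inv_im]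
    simp only [Complex.sub_im, Complex.ofReal_im, sub_zero]
    rw [neg_div, neg_neg]
    positivity
  have hint : Integrable (fun x : ℝ => -((w - (x:ℂ))⁻¹).im) ν := (ct_integrable ν w hw).im.neg
  have : 0 < ∫ x : ℝ, -((w - (x:ℂ))⁻¹).im ∂ν := by
    rw [integral_pos_iff_support_of_nonneg (fun x => (hpt x).le) hint]
    have : Function.support (fun x : ℝ => -((w - (x:ℂ))⁻¹).im) = Set.univ :=
      Set.eq_univ_of_forall (fun x => (hpt x).ne')
    rw [this]; simp
  rw [integral_neg] at this
  linarith

lemma ct_ne_zero (ν : Measure ℝ) [IsProbabilityMeasure ν] (w : ℂ) (hw : 0 < w.im) :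
    cauchyTransform ν w ≠ 0 := by
  intro h
  have := ct_im_neg ν w hw
  rw [h] at this; simp at this

/-- membership in the disc with diameter `[-i/y, 0]` -/
lemma ct_disc {g : ℂ} {y : ℝ} (hy : 0 < y) :
    ‖g + ((2 * y)⁻¹ : ℝ) * Complex.I‖ ≤ (2 * y)⁻¹ ↔ y * Complex.normSq g ≤ -g.im := by
  have h1 : ‖g + ((2 * y)⁻¹ : ℝ) * Complex.I‖ ^ 2 = Complex.normSq g + g.im * y⁻¹ + ((2*y)⁻¹)^2 := by
    rw [← Complex.normSq_eq_norm_sq]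
    simp only [Complex.normSq_apply, Complex.add_re, Complex.add_im, Complex.mul_re, Complex.mul_im,
      Complex.ofReal_re, Complex.ofReal_im, Complex.I_re, Complex.I_im]
    field_simp
    ring
  rw [← sq_le_sq₀ (norm_nonneg _) (by positivity), h1]
  have : Complex.normSq g + g.im * y⁻¹ = (y * Complex.normSq g + g.im) * y⁻¹ := by
    field_simp
  constructor
  · intro h
    have h2 : (y * Complex.normSq g + g.im) * y⁻¹ ≤ 0 := by linarith
    have h3 := nonpos_of_mul_nonpos_left h2 (by positivity)
    linarith
  · intro h
    have h2 : (y * Complex.normSq g + g.im) * y⁻¹ ≤ 0 :=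
      mul_nonpos_of_nonpos_of_nonneg (by linarith) (by positivity)
    linarith

lemma ct_inv_im_le (ν : Measure ℝ) [IsProbabilityMeasure ν] (w : ℂ) (hw : 0 < w.im) :
    w.im ≤ ((cauchyTransform ν w)⁻¹).im := by
  have hN := Complex.normSq_pos.2 (ct_ne_zero ν w hw)
  rw [Complex.inv_im, le_div_iff₀ hN, ← ct_disc hw]
  have hpt : ∀ x : ℝ, ‖(w - (x:ℂ))⁻¹ + ((2 * w.im)⁻¹ : ℝ) * Complex.I‖ ≤ (2 * w.im)⁻¹ := by
    intro x
    have h0 : 0 < Complex.normSq (w - (x:ℂ)) := Complex.normSq_pos.2 (ct_sub_ne w hw x)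
    rw [ct_disc hw, Complex.inv_im, Complex.normSq_inv]
    simp [div_eq_mul_inv]
  have := norm_integral_le_of_norm_le_const (μ := ν) (Filter.Eventually.of_forall hpt)
  rw [integral_add (ct_integrable ν w hw) (integrable_const _)] at this
  simpa [cauchyTransform] using this

lemma ct_lip (ν : Measure ℝ) [IsProbabilityMeasure ν] (c : ℝ) (hc : 0 < c) (w v : ℂ)
    (hw : c ≤ w.im) (hv : c ≤ v.im) :
    ‖cauchyTransform ν w - cauchyTransform ν v‖ ≤ (c ^ 2)⁻¹ * ‖w - v‖ := by
  have hw0 := hc.trans_le hw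
  have hv0 := hc.trans_le hv
  unfold cauchyTransform
  rw [← integral_sub (ct_integrable ν w hw0) (ct_integrable ν v hv0)]
  have hpt : ∀ x : ℝ, ‖(w - (x:ℂ))⁻¹ - (v - (x:ℂ))⁻¹‖ ≤ (c ^ 2)⁻¹ * ‖w - v‖ := by
    intro x
    have e : (w - (x:ℂ))⁻¹ - (v - (x:ℂ))⁻¹ = (w - (x:ℂ))⁻¹ * (v - (x:ℂ))⁻¹ * (v - w) := by
      have := ct_sub_ne w hw0 x
      have := ct_sub_ne v hv0 x
      field_simp
      ring
    rw [e, norm_mul, norm_mul, norm_sub_rev v w]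
    have a := (ct_norm_inv_le w hw0 x).trans (inv_anti₀ hc hw)
    have b := (ct_norm_inv_le v hv0 x).trans (inv_anti₀ hc hv)
    rw [show (c^2)⁻¹ = c⁻¹ * c⁻¹ by rw [sq, mul_inv]]
    gcongr
  have := norm_integral_le_of_norm_le_const (μ := ν) (Filter.Eventually.of_forall hpt)
  simpa using this

lemma ct_banach (t : ℝ) (ht : 0 < t) (ν : Measure ℝ) [IsProbabilityMeasure ν]
    (z : ℂ) (hz : 2 * Real.sqrt t < z.im) :
    ∃! w : ℂ, z.im / 2 < w.im ∧ w = z + (t : ℂ) * cauchyTransform ν w := by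
  have hs : 0 < √t := Real.sqrt_pos.2 ht
  have hss : √t * √t = t := Real.mul_self_sqrt ht.le
  set c := z.im / 2 with hcdef
  have hc : √t < c := by rw [hcdef]; linarith
  have hc0 : 0 < c := hs.trans hc
  have hK : t * (c ^ 2)⁻¹ < 1 := by
    rw [← div_eq_mul_inv, div_lt_one (by positivity)]; nlinarith
  have hK0 : 0 ≤ t * (c ^ 2)⁻¹ := by positivity
  let f : ℂ → ℂ := fun w => z + (t : ℂ) * cauchyTransform ν w
  have hf : ∀ w v : ℂ, c ≤ w.im → c ≤ v.im → dist (f w) (f v) ≤ t * (c ^ 2)⁻¹ * dist w v := by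
    intro w v hw hv
    have := ct_lip ν c hc0 w v hw hv
    rw [dist_eq_norm, dist_eq_norm]
    have e : f w - f v = (t:ℂ) * (cauchyTransform ν w - cauchyTransform ν v) := by
      simp only [f]; ring
    rw [e, norm_mul, Complex.norm_real, Real.norm_of_nonneg ht.le, mul_assoc]
    gcongr
  have hmaps : ∀ w : ℂ, c ≤ w.im → c < (f w).im := by
    intro w hw
    have h1 := (ct_norm_le ν w (hc0.trans_le hw)).trans (inv_anti₀ hc0 hw)
    have h2 := (Complex.abs_im_le_norm (cauchyTransform ν w)).trans h1
    have h3 := (abs_le.1 h2).1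
    have h4 : (f w).im = z.im + t * (cauchyTransform ν w).im := by simp [f]
    have h5 : t * c⁻¹ < c := by
      rw [← div_eq_mul_inv, div_lt_iff₀ hc0]; nlinarith
    rw [h4]
    have : z.im = 2 * c := by rw [hcdef]; ring
    nlinarith
  let s : Set ℂ := {w | c ≤ w.im}
  have hsc : IsComplete s := (isClosed_le continuous_const Complex.continuous_im).isComplete
  have hm : Set.MapsTo f s s := fun w hw => (hmaps w hw).le
  have hcon : ContractingWith ⟨t * (c ^ 2)⁻¹, hK0⟩ (hm.restrict f s s) := by
    refine ⟨by exact_mod_cast hK, LipschitzWith.of_dist_le_mul ?_⟩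
    rintro ⟨w, hw⟩ ⟨v, hv⟩
    exact hf w v hw hv
  obtain ⟨w, hw, hfix, -⟩ := hcon.exists_fixedPoint' hsc hm (x := z)
    (show c ≤ z.im by linarith) (edist_ne_top _ _)
  have hfix' : f w = w := hfix
  refine ⟨w, ⟨?_, hfix'.symm⟩, ?_⟩
  · have := hmaps w hw
    rwa [hfix'] at this
  · rintro v ⟨hv, hvf⟩
    have h := hf v w hv.le hw
    rw [hfix', show f v = v from hvf.symm] at h
    have : dist v w ≤ 0 := by
      by_contra! h0
      nlinarith
    exact dist_le_zero.1 this

lemma sc_denom (q : ℂ) (θ : ℝ) : 1 - 2 * q * Complex.cos θ + q ^ 2 =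
    (1 - q * Complex.exp (θ * Complex.I)) * (1 - q * Complex.exp (-θ * Complex.I)) := by
  have h : Complex.exp (θ * Complex.I) * Complex.exp (-θ * Complex.I) = 1 := by
    rw [← Complex.exp_add]; simp
  rw [Complex.cos]
  linear_combination (-q^2) * h

lemma sc_series (q : ℂ) (hq : ‖q‖ < 1) (θ : ℝ) :
    HasSum (fun n : ℕ => q ^ n * Complex.sin ((n + 1) * θ) * Complex.sin θ)
      (Complex.sin θ ^ 2 / (1 - 2 * q * Complex.cos θ + q ^ 2)) := by
  have n1 : ‖q * Complex.exp (θ * Complex.I)‖ < 1 := by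
    rw [norm_mul, Complex.norm_exp_ofReal_mul_I, mul_one]; exact hq
  have n2 : ‖q * Complex.exp (-θ * Complex.I)‖ < 1 := by
    have := Complex.norm_exp_ofReal_mul_I (-θ)
    push_cast at this
    rw [norm_mul, this, mul_one]; exact hq
  have d1 : 1 - q * Complex.exp (θ * Complex.I) ≠ 0 := by
    intro h
    rw [← sub_eq_zero.1 h] at n1; simp at n1
  have d2 : 1 - q * Complex.exp (-θ * Complex.I) ≠ 0 := by
    intro h
    rw [← sub_eq_zero.1 h] at n2; simp at n2
  have s1 := (hasSum_geometric_of_norm_lt_one n1).mul_left (Complex.exp (θ * Complex.I))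
  have s2 := (hasSum_geometric_of_norm_lt_one n2).mul_left (Complex.exp (-θ * Complex.I))
  have s := ((s2.sub s1).mul_right (Complex.I / 2)).mul_right (Complex.sin θ)
  convert! s using 1
  · funext n
    have e1 : Complex.exp ((n+1) * θ * Complex.I) = Complex.exp (θ * Complex.I) ^ (n+1) := by
      rw [← Complex.exp_nat_mul]; push_cast; ring_nf
    have e2 : Complex.exp (-((n+1) * θ) * Complex.I) = Complex.exp (-θ * Complex.I) ^ (n+1) := by
      rw [← Complex.exp_nat_mul]; push_cast; ring_nf
    rw [show Complex.sin ((n+1) * θ) = (Complex.exp (-((n+1) * θ) * Complex.I) -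
      Complex.exp ((n+1) * θ * Complex.I)) * Complex.I / 2 from rfl, e1, e2, mul_pow, mul_pow]
    ring
  · rw [sc_denom, sq, mul_div_assoc, mul_comm]
    congr 1
    rw [show Complex.sin θ = (Complex.exp (-θ * Complex.I) -
      Complex.exp (θ * Complex.I)) * Complex.I / 2 from rfl]
    generalize Complex.exp (-θ * Complex.I) = A at *
    generalize Complex.exp (θ * Complex.I) = B at *
    have e1 := mul_inv_cancel₀ d1
    have e2 := mul_inv_cancel₀ d2
    rw [div_eq_mul_inv, mul_inv]
    linear_combination (Complex.I / 2) * (A * (1 - q * A)⁻¹ * e1 - B * (1 - q * B)⁻¹ * e2)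

lemma sc_int (n : ℕ) : ∫ θ in (0:ℝ)..Real.pi, Complex.sin ((n + 1) * θ) * Complex.sin θ =
    if n = 0 then (Real.pi / 2 : ℂ) else 0 := by
  have e : ∀ θ : ℝ, Complex.sin ((n + 1) * θ) * Complex.sin θ =
      (Complex.cos ((n:ℂ) * θ) - Complex.cos (((n + 2 : ℕ) : ℂ) * θ)) / 2 := by
    intro θ
    rw [show (n:ℂ) * θ = (n+1) * θ - θ by ring,
      show ((n + 2 : ℕ) : ℂ) * θ = (n+1) * θ + θ by push_cast; ring, Complex.cos_sub, Complex.cos_add]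
    ring
  simp_rw [e]
  rw [intervalIntegral.integral_div, intervalIntegral.integral_sub
    (Continuous.intervalIntegrable (by fun_prop) _ _)
    (Continuous.intervalIntegrable (by fun_prop) _ _),
    integral_cos_mul_complex (z := ((n+2 : ℕ) : ℂ)) (Nat.cast_ne_zero.2 (Nat.succ_ne_zero _)),
    Complex.sin_nat_mul_pi]
  split_ifs with h
  · subst h; simp
  · rw [integral_cos_mul_complex (z := (n : ℂ)) (by exact_mod_cast h), Complex.sin_nat_mul_pi]
    simp

lemma sc_theta (q : ℂ) (hq : ‖q‖ < 1) :
    ∫ θ in (0:ℝ)..Real.pi, Complex.sin θ ^ 2 / (1 - 2 * q * Complex.cos θ + q ^ 2) =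
      (Real.pi / 2 : ℂ) := by
  have h := intervalIntegral.hasSum_integral_of_dominated_convergence (μ := volume)
    (a := 0) (b := Real.pi)
    (F := fun (n : ℕ) (θ : ℝ) => q ^ n * Complex.sin ((n + 1) * θ) * Complex.sin θ)
    (f := fun θ : ℝ => Complex.sin θ ^ 2 / (1 - 2 * q * Complex.cos θ + q ^ 2))
    (fun n _ => ‖q‖ ^ n)
    (fun n => Continuous.aestronglyMeasurable (by fun_prop))
    (fun n => Filter.Eventually.of_forall fun θ _ => by
      have a1 : ‖Complex.sin ((n + 1) * θ)‖ ≤ 1 := by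
        have : Complex.sin ((n + 1) * θ) = ((Real.sin ((n+1) * θ) : ℝ) : ℂ) := by push_cast; rfl
        rw [this, Complex.norm_real]; exact Real.abs_sin_le_one _
      have a2 : ‖Complex.sin θ‖ ≤ 1 := by
        rw [← Complex.ofReal_sin, Complex.norm_real]; exact Real.abs_sin_le_one _
      rw [norm_mul, norm_mul, norm_pow]
      calc _ ≤ ‖q‖ ^ n * 1 * 1 := by gcongr
        _ = _ := by ring)
    (Filter.Eventually.of_forall fun θ _ => summable_geometric_of_lt_one (norm_nonneg _) hq)
    (by simp)
    (Filter.Eventually.of_forall fun θ _ => sc_series q hq θ)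
  have h2 : HasSum (fun n : ℕ => if n = 0 then (Real.pi / 2 : ℂ) else 0) (Real.pi / 2 : ℂ) :=
    hasSum_ite_eq 0 _
  refine h.unique ?_
  convert! h2 using 1
  funext n
  simp_rw [mul_assoc]
  rw [intervalIntegral.integral_const_mul, sc_int]
  split_ifs with h0
  · simp [h0]
  · simp

lemma sc_eval (t : ℝ) (ht : 0 < t) (u g : ℂ) (hu : 0 < u.im) (hg0 : g ≠ 0)
    (hg : ‖g‖ * √t < 1) (hug : u = t * g + g⁻¹) : cauchyTransform (semicircle t) u = g := by
  have hs : 0 < √t := Real.sqrt_pos.2 ht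
  have hss : √t ^ 2 = t := Real.sq_sqrt ht.le
  have hsC : (√t : ℂ) ^ 2 = t := by exact_mod_cast hss
  have hsC0 : (√t : ℂ) ≠ 0 := by exact_mod_cast hs.ne'
  have hpi : (Real.pi : ℂ) ≠ 0 := by exact_mod_cast Real.pi_ne_zero
  have hne : ∀ x : ℝ, u - (x:ℂ) ≠ 0 := by
    intro x h
    have := congrArg Complex.im h
    simp at this
    linarith
  let F : ℝ → ℂ := fun x => (((2 * Real.pi * t)⁻¹ * √(4 * t - x ^ 2) : ℝ) : ℂ) * (u - (x:ℂ))⁻¹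
  have hFc : Continuous F := by
    apply Continuous.mul
    · fun_prop
    · exact Continuous.inv₀ (by fun_prop) hne
  have h1 : cauchyTransform (semicircle t) u = ∫ x, F x := by
    unfold cauchyTransform semicircle
    rw [integral_withDensity_eq_integral_toReal_smul (by fun_prop)
      (Filter.Eventually.of_forall fun x => ENNReal.ofReal_lt_top)]
    congr 1
    funext x
    rw [ENNReal.toReal_ofReal (by positivity), Complex.real_smul]
  have h2 : ∫ x, F x = ∫ x in (-(2 * √t))..(2 * √t), F x := by
    rw [intervalIntegral.integral_of_le (by linarith), ← integral_Icc_eq_integral_Ioc]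
    symm
    apply setIntegral_eq_integral_of_forall_compl_eq_zero
    intro x hx
    have : 4 * t - x ^ 2 ≤ 0 := by
      by_contra! h
      apply hx
      have := abs_le_of_sq_le_sq' (show x ^ 2 ≤ (2 * √t) ^ 2 by nlinarith) (by positivity)
      exact this
    simp [F, Real.sqrt_eq_zero_of_nonpos this]
  have h3 := intervalIntegral.integral_deriv_smul_comp (a := 0) (b := Real.pi)
    (f := fun θ => 2 * √t * Real.cos θ) (f' := fun θ => 2 * √t * (-Real.sin θ)) (g := F)
    (fun θ _ => (Real.hasDerivAt_cos θ).const_mul _) (by fun_prop) hFc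
  simp only [Real.cos_zero, Real.cos_pi, mul_one, mul_neg] at h3
  rw [h1, h2, intervalIntegral.integral_symm, ← h3, ← intervalIntegral.integral_neg]
  let q : ℂ := g * √t
  have hq : ‖q‖ < 1 := by
    simpa [q, abs_of_pos hs] using hg
  have hpt : ∀ θ ∈ Set.uIcc 0 Real.pi, -((-(2 * √t * Real.sin θ)) • (F ∘ fun θ => 2 * √t * Real.cos θ) θ)
      = (2 * g / Real.pi) * (Complex.sin θ ^ 2 / (1 - 2 * q * Complex.cos θ + q ^ 2)) := by
    intro θ hθ
    rw [Set.uIcc_of_le Real.pi_pos.le] at hθ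
    have hsin : 0 ≤ Real.sin θ := Real.sin_nonneg_of_mem_Icc hθ
    have hsq : √(4 * t - (2 * √t * Real.cos θ) ^ 2) = 2 * √t * Real.sin θ := by
      rw [show 4 * t - (2 * √t * Real.cos θ) ^ 2 = (2 * √t * Real.sin θ) ^ 2 by
        have := Real.sin_sq_add_cos_sq θ
        linear_combination (-4 * √t ^ 2) * this - 4 * hss]
      exact Real.sqrt_sq (by positivity)
    have hd : 1 - 2 * q * Complex.cos θ + q ^ 2 = g * (u - ((2 * √t * Real.cos θ : ℝ) : ℂ)) := by
      rw [hug]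
      push_cast
      simp only [q]
      field_simp
      rw [← hsC]
      ring
    have := hne (2 * √t * Real.cos θ)
    rw [hd]
    simp only [F, Function.comp, hsq, Complex.real_smul]
    generalize u - ((2 * √t * Real.cos θ : ℝ) : ℂ) = D at *
    push_cast
    rw [← hsC]
    field_simp
  rw [intervalIntegral.integral_congr hpt, intervalIntegral.integral_const_mul, sc_theta q hq]
  field_simp

lemma sc_root (t : ℝ) (ht : 0 < t) (u : ℂ) (hu : 0 < u.im) :
    ∃ g : ℂ, g ≠ 0 ∧ ‖g‖ * √t < 1 ∧ u = t * g + g⁻¹ := by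
  have hs : 0 < √t := Real.sqrt_pos.2 ht
  have hss : √t * √t = t := Real.mul_self_sqrt ht.le
  have htC : (t : ℂ) ≠ 0 := by exact_mod_cast ht.ne'
  obtain ⟨d, hd⟩ := IsAlgClosed.exists_pow_nat_eq (u ^ 2 - 4 * t) (n := 2) (by norm_num)
  -- one root
  obtain ⟨g, hg⟩ : ∃ g : ℂ, t * g ^ 2 - u * g + 1 = 0 := by
    refine ⟨(u + d) / (2 * t), ?_⟩
    field_simp
    linear_combination hd
  have key : ∀ g : ℂ, t * g ^ 2 - u * g + 1 = 0 → g ≠ 0 ∧ u = t * g + g⁻¹ := by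
    intro g hg
    have h0 : g ≠ 0 := by rintro rfl; simp at hg
    refine ⟨h0, ?_⟩
    field_simp
    linear_combination -hg
  obtain ⟨g0, hgu⟩ := key g hg
  have hgn : 0 < ‖g‖ := norm_pos_iff.2 g0
  rcases lt_trichotomy (‖g‖ * √t) 1 with h | h | h
  · exact ⟨g, g0, h, hgu⟩
  · exfalso
    have hN : t * Complex.normSq g = 1 := by
      rw [Complex.normSq_eq_norm_sq]
      calc t * ‖g‖ ^ 2 = (‖g‖ * √t) ^ 2 := by rw [mul_pow, sq (√t), hss]; ring
        _ = 1 := by rw [h]; norm_num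
    have hNpos : 0 < Complex.normSq g := Complex.normSq_pos.2 g0
    have : u.im = 0 := by
      rw [hgu]
      simp only [Complex.add_im, Complex.mul_im, Complex.ofReal_re, Complex.ofReal_im,
        Complex.inv_im]
      field_simp
      linear_combination g.im * hN
    linarith
  · have hg' : (t:ℂ) * ((t * g)⁻¹) ^ 2 - u * (t * g)⁻¹ + 1 = 0 := by
      field_simp
      linear_combination hg
    obtain ⟨a, b⟩ := key _ hg'
    refine ⟨_, a, ?_, b⟩
    rw [norm_inv, norm_mul, Complex.norm_real, Real.norm_of_nonneg ht.le, inv_mul_eq_div,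
      div_lt_one (by positivity)]
    nlinarith

/-- For `t > 0`, a probability measure `ν` and `Im z > 2√t`, there is exactly one `w` with
`Im w > Im z / 2` satisfying `w = z + t G_{σ_t}(w + 1/G_ν(w) − z)`. -/
theorem existsUnique_fixedPoint (t : ℝ) (ht : 0 < t) (ν : Measure ℝ) [IsProbabilityMeasure ν]
    (z : ℂ) (hz : 2 * Real.sqrt t < z.im) :
    ∃! w : ℂ, z.im / 2 < w.im ∧
      w = z + (t : ℂ) * cauchyTransform (semicircle t) (w + (cauchyTransform ν w)⁻¹ - z) := by
  have hs : 0 < √t := Real.sqrt_pos.2 ht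
  have key : ∀ w : ℂ, (z.im / 2 < w.im ∧
      w = z + (t : ℂ) * cauchyTransform (semicircle t) (w + (cauchyTransform ν w)⁻¹ - z)) ↔
      (z.im / 2 < w.im ∧ w = z + (t : ℂ) * cauchyTransform ν w) := by
    intro w
    refine and_congr_right fun hw => ?_
    have hw0 : 0 < w.im := by linarith
    have hG0 := ct_ne_zero ν w hw0
    have hGn := ct_norm_le ν w hw0
    have hu : 0 < (w + (cauchyTransform ν w)⁻¹ - z).im := by
      have := ct_inv_im_le ν w hw0
      rw [Complex.sub_im, Complex.add_im]
      linarith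
    constructor
    · intro h
      obtain ⟨g, hg0, hg1, hg⟩ := sc_root t ht _ hu
      rw [sc_eval t ht _ g hu hg0 hg1 hg] at h
      have : (cauchyTransform ν w)⁻¹ = g⁻¹ := by linear_combination hg - h
      rw [inv_inj.1 this]
      exact h
    · intro h
      rw [sc_eval t ht _ (cauchyTransform ν w) hu hG0 ?_ ?_]
      · exact h
      · calc ‖cauchyTransform ν w‖ * √t ≤ w.im⁻¹ * √t := by gcongr
          _ < 1 := by
            rw [inv_mul_eq_div, div_lt_one hw0]
            linarith
      · linear_combination h
  simp only [key]
  exact ct_banach t ht ν z hz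
end
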